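/- arXiv:math/0511428 — 2 statements merged into one kernel-verified Lean document; each statement's English description precedes it below -/
import Mathlib

section
/- Let n be a natural number with n ≥ 2, and choose two permutations of {1,…,n} independently and uniformly at random. The probability that the two permutations have the same number of cycles is asymptotic, as n → ∞, to 1/(2·√(π·log n)). Equivalently, the number of ordered pairs (σ, τ) of permutations of an n-element set such that σ and τ have the same number of cycles, divided by (n!)², tends to 1 when multiplied by 2·√(π·log n). -/
open Filter

/-- The number of cycles of a permutation of `Fin n` (fixed points count as cycles):
the number of orbits of the cyclic group generated by the permutation. -/
noncomputable def cycleCount (n : ℕ) (σ : Equiv.Perm (Fin n)) : ℕ :=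
  Nat.card (MulAction.orbitRel.Quotient (Subgroup.zpowers σ) (Fin n))

/-- Two-colourings invariant under `σ` are arbitrary two-colourings of its cycles. -/
lemma two_pow_cycleCount (n : ℕ) (σ : Equiv.Perm (Fin n)) :
    2 ^ cycleCount n σ = Nat.card {f : Fin n → Bool // ∀ i, f (σ i) = f i} := by
  have e : (MulAction.orbitRel.Quotient (Subgroup.zpowers σ) (Fin n) → Bool) ≃
      {f : Fin n → Bool // ∀ i, f (σ i) = f i} :=
    { toFun := fun g => ⟨fun i => g (Quotient.mk _ i), fun i => by
        exact congrArg g (Quotient.sound (s := MulAction.orbitRel (Subgroup.zpowers σ) (Fin n))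
          (a := σ i) (b := i) ⟨⟨σ, Subgroup.mem_zpowers σ⟩, rfl⟩)⟩
      invFun := fun f => Quotient.lift f.1 (by
        rintro a b ⟨⟨g, hg⟩, rfl⟩
        have key : ∀ k : ℤ, ∀ i, f.1 ((σ ^ k) i) = f.1 i := by
          intro k
          induction k with
          | zero => simp
          | succ k ih =>
            intro i
            rw [add_comm, zpow_add, zpow_one, Equiv.Perm.mul_apply, f.2, ih]
          | pred k ih =>
            intro i
            rw [← f.2, ← Equiv.Perm.mul_apply, ← zpow_one_add, add_sub_cancel, ih]
        obtain ⟨k, rfl⟩ := hg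
        exact key k b)
      left_inv := fun g => by
        ext q
        induction q using Quotient.inductionOn
        rfl
      right_inv := fun f => rfl }
  rw [← Nat.card_congr e]
  simp [cycleCount, Nat.card_fun]

lemma cycleCount_decomposeFin_symm (n : ℕ) (p : Fin (n + 1)) (e : Equiv.Perm (Fin n)) :
    cycleCount (n + 1) (Equiv.Perm.decomposeFin.symm (p, e)) =
      cycleCount n e + if p = 0 then 1 else 0 := by
  apply Nat.pow_right_injective (le_refl 2)
  simp only [two_pow_cycleCount, pow_add]
  induction p using Fin.cases with
  | zero =>
    have E : {f : Fin (n + 1) → Bool //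
        ∀ i, f (Equiv.Perm.decomposeFin.symm (0, e) i) = f i} ≃
        {f : Fin n → Bool // ∀ i, f (e i) = f i} × Bool :=
      { toFun := fun f => (⟨fun i => f.1 i.succ, fun i => by simpa using f.2 i.succ⟩, f.1 0)
        invFun := fun f => ⟨Fin.cons f.2 f.1.1, fun i => by
          induction i using Fin.cases <;> simp [f.1.2]⟩
        left_inv := fun f => by
          ext i
          induction i using Fin.cases <;> rfl
        right_inv := fun f => rfl }
    exact (Nat.card_congr E).trans (by simp)
  | succ p =>
    have E : {f : Fin (n + 1) → Bool //
        ∀ i, f (Equiv.Perm.decomposeFin.symm (p.succ, e) i) = f i} ≃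
        {f : Fin n → Bool // ∀ i, f (e i) = f i} :=
      { toFun := fun f => ⟨fun i => f.1 i.succ, fun i => by
          have h0 := f.2 0
          have h := f.2 i.succ
          simp only [Equiv.Perm.decomposeFin_symm_apply_zero,
            Equiv.Perm.decomposeFin_symm_apply_succ] at h0 h
          by_cases hp : e i = p
          · subst hp
            rw [Equiv.swap_apply_right] at h
            exact h0.trans h
          · rwa [Equiv.swap_apply_of_ne_of_ne (Fin.succ_ne_zero _) (by simpa using hp)] at h⟩
        invFun := fun f => ⟨Fin.cons (f.1 p) f.1, fun i => by
          induction i using Fin.cases with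
          | zero => simp
          | succ i =>
            simp only [Equiv.Perm.decomposeFin_symm_apply_succ]
            by_cases hp : e i = p
            · subst hp
              simp [f.2]
            · rw [Equiv.swap_apply_of_ne_of_ne (Fin.succ_ne_zero _) (by simpa using hp)]
              simp [f.2]⟩
        left_inv := fun f => by
          ext i
          induction i using Fin.cases with
          | zero => simpa using f.2 0
          | succ i => rfl
        right_inv := fun f => rfl }
    exact (Nat.card_congr E).trans (by simp)

lemma sum_pow_cycleCount (n : ℕ) (z : ℂ) :
    ∑ σ : Equiv.Perm (Fin n), z ^ cycleCount n σ = ∏ j ∈ Finset.range n, (z + j) := by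
  induction n with
  | zero => simp [cycleCount]
  | succ n ih =>
    rw [Finset.prod_range_succ, ← ih, ← Equiv.Perm.decomposeFin.symm.sum_comp,
      Fintype.sum_prod_type, Fin.sum_univ_succ]
    simp only [cycleCount_decomposeFin_symm, Fin.succ_ne_zero, if_true, if_false, pow_add]
    simp [← Finset.sum_mul]
    ring

lemma integral_cos_natCast_sub (a b : ℕ) :
    ∫ t in -Real.pi..Real.pi, Real.cos (((a : ℝ) - b) * t) =
      if a = b then 2 * Real.pi else 0 := by
  split_ifs with h
  · simp [h, two_mul]
  · have h' : (a : ℝ) - b ≠ 0 := sub_ne_zero.2 (by exact_mod_cast h)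
    rw [intervalIntegral.integral_comp_mul_left _ h', integral_cos]
    have hs : Real.sin (((a : ℝ) - b) * Real.pi) = 0 := by
      have := Real.sin_int_mul_pi ((a : ℤ) - b)
      exact_mod_cast this
    simp [hs]


lemma card_same_cycleCount_mul (n : ℕ) :
    (Nat.card {p : Equiv.Perm (Fin n) × Equiv.Perm (Fin n) //
        cycleCount n p.1 = cycleCount n p.2} : ℝ) * (2 * Real.pi) =
      ∫ t in -Real.pi..Real.pi,
        ∏ j ∈ Finset.range n, (((j : ℝ) + 1) ^ 2 - 2 * j * (1 - Real.cos t)) := by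
  have hexp (t : ℝ) : ∏ j ∈ Finset.range n, (((j : ℝ) + 1) ^ 2 - 2 * j * (1 - Real.cos t)) =
      ∑ σ : Equiv.Perm (Fin n), ∑ τ : Equiv.Perm (Fin n),
        Real.cos (((cycleCount n σ : ℝ) - cycleCount n τ) * t) := by
    have hpow (k : ℕ) : Complex.exp (t * Complex.I) ^ k =
        Real.cos (k * t) + Real.sin (k * t) * Complex.I := by
      rw [← Complex.exp_nat_mul, ← mul_assoc, Complex.exp_mul_I]
      push_cast
      rfl
    have h := congrArg Complex.normSq (sum_pow_cycleCount n (Complex.exp (t * Complex.I)))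
    simp only [hpow, map_prod] at h
    rw [Complex.normSq_apply] at h
    simp only [Complex.re_sum, Complex.im_sum, Complex.add_re, Complex.add_im,
      Complex.ofReal_re, Complex.ofReal_im, Complex.re_ofReal_mul, Complex.im_ofReal_mul,
      Complex.I_re, Complex.I_im, mul_zero, mul_one, add_zero, zero_add,
      Finset.sum_mul_sum, ← Finset.sum_add_distrib] at h
    calc
      _ = ∏ j ∈ Finset.range n, Complex.normSq (Complex.exp (t * Complex.I) + j) := by
        refine Finset.prod_congr rfl fun j _ => ?_
        rw [Complex.normSq_apply]
        simp [Complex.exp_ofReal_mul_I_re, Complex.exp_ofReal_mul_I_im]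
        nlinarith [Real.sin_sq_add_cos_sq t]
      _ = _ := by
        rw [← h]
        simp only [sub_mul, Real.cos_sub]
  simp_rw [hexp]
  rw [intervalIntegral.integral_finsetSum
    fun σ _ => Continuous.intervalIntegrable (by fun_prop) _ _]
  have hinner (σ : Equiv.Perm (Fin n)) :
      ∫ t in -Real.pi..Real.pi, ∑ τ : Equiv.Perm (Fin n),
        Real.cos (((cycleCount n σ : ℝ) - cycleCount n τ) * t) =
      ∑ τ : Equiv.Perm (Fin n), if cycleCount n σ = cycleCount n τ then 2 * Real.pi else 0 := by
    rw [intervalIntegral.integral_finsetSum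
      fun τ _ => Continuous.intervalIntegrable (by fun_prop) _ _]
    simp only [integral_cos_natCast_sub]
  simp only [hinner]
  rw [← Fintype.sum_prod_type' fun σ τ : Equiv.Perm (Fin n) =>
    if cycleCount n σ = cycleCount n τ then 2 * Real.pi else 0, ← Finset.sum_filter,
    Finset.sum_const, nsmul_eq_mul, Nat.card_eq_fintype_card, Fintype.card_subtype]

/-- The squared modulus of the characteristic function of the cycle count. -/
noncomputable def cycleCharSq (n : ℕ) (t : ℝ) : ℝ :=
  ∏ j ∈ Finset.range n, (1 - 2 * (1 - Real.cos t) * (j / ((j : ℝ) + 1) ^ 2))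

/-- The normalizing sum, equal to the variance of the cycle count. -/
noncomputable def cycleVar (n : ℕ) : ℝ :=
  ∑ j ∈ Finset.range n, j / ((j : ℝ) + 1) ^ 2

lemma card_same_cycleCount_div (n : ℕ) :
    (Nat.card {p : Equiv.Perm (Fin n) × Equiv.Perm (Fin n) //
        cycleCount n p.1 = cycleCount n p.2} : ℝ) / (n.factorial : ℝ) ^ 2 =
      (2 * Real.pi)⁻¹ * ∫ t in -Real.pi..Real.pi, cycleCharSq n t := by
  have hf : ((n.factorial : ℝ) ^ 2) = ∏ j ∈ Finset.range n, ((j : ℝ) + 1) ^ 2 := by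
    rw [← Finset.prod_range_add_one_eq_factorial, Finset.prod_pow]
    push_cast
    rfl
  have h (t : ℝ) : cycleCharSq n t =
      (∏ j ∈ Finset.range n, (((j : ℝ) + 1) ^ 2 - 2 * j * (1 - Real.cos t))) /
        (n.factorial : ℝ) ^ 2 := by
    rw [hf, ← Finset.prod_div_distrib]
    refine Finset.prod_congr rfl fun j _ => ?_
    have : (j : ℝ) + 1 ≠ 0 := by positivity
    field_simp
  simp_rw [h]
  rw [intervalIntegral.integral_div, ← card_same_cycleCount_mul]
  field_simp

lemma tendsto_cycleVar_div_log :
    Tendsto (fun n : ℕ => cycleVar n / Real.log n) atTop (nhds 1) := by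
  have hlog : Tendsto (fun n : ℕ => Real.log n) atTop atTop :=
    Real.tendsto_log_atTop.comp tendsto_natCast_atTop_atTop
  have hsum : Summable fun j : ℕ => 1 / ((j : ℝ) + 1) ^ 2 := by
    have := (summable_nat_add_iff 1).2 (Real.summable_one_div_nat_pow.2 one_lt_two)
    exact_mod_cast this
  have hdiff := Real.tendsto_harmonic_sub_log.sub hsum.hasSum.tendsto_sum_nat
  have h := (hdiff.div_atTop hlog).const_add 1
  rw [add_zero] at h
  refine h.congr' ?_
  filter_upwards [hlog.eventually_gt_atTop 0] with n hn
  have hv : cycleVar n = (harmonic n : ℝ) - ∑ j ∈ Finset.range n, 1 / ((j : ℝ) + 1) ^ 2 := by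
    rw [cycleVar, harmonic]
    push_cast
    rw [← Finset.sum_sub_distrib]
    refine Finset.sum_congr rfl fun j _ => ?_
    have : (j : ℝ) + 1 ≠ 0 := by positivity
    field_simp
    ring
  rw [hv]
  field_simp
  ring

lemma div_succ_sq_mem (j : ℕ) :
    0 ≤ (j : ℝ) / ((j : ℝ) + 1) ^ 2 ∧ (j : ℝ) / ((j : ℝ) + 1) ^ 2 ≤ 1 / 4 := by
  refine ⟨by positivity, ?_⟩
  rw [div_le_div_iff₀ (by positivity) (by norm_num)]
  nlinarith [sq_nonneg ((j : ℝ) - 1)]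

lemma cycleCharSq_nonneg (n : ℕ) (t : ℝ) : 0 ≤ cycleCharSq n t := by
  refine Finset.prod_nonneg fun j _ => ?_
  obtain ⟨h0, h1⟩ := div_succ_sq_mem j
  nlinarith [Real.neg_one_le_cos t, Real.cos_le_one t]

lemma cycleCharSq_le (n : ℕ) (t : ℝ) :
    cycleCharSq n t ≤ Real.exp (-(2 * (1 - Real.cos t) * cycleVar n)) := by
  rw [cycleVar, Finset.mul_sum, ← Finset.sum_neg_distrib, Real.exp_sum]
  refine Finset.prod_le_prod (fun j _ => ?_) fun j _ => Real.one_sub_le_exp_neg _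
  obtain ⟨h0, h1⟩ := div_succ_sq_mem j
  nlinarith [Real.neg_one_le_cos t, Real.cos_le_one t]

lemma le_cycleCharSq (n : ℕ) (t : ℝ) (ht : 0 < Real.cos t) :
    Real.exp (-(2 * (1 - Real.cos t) * cycleVar n) / Real.cos t) ≤ cycleCharSq n t := by
  rw [cycleVar, Finset.mul_sum, ← Finset.sum_neg_distrib, Finset.sum_div, Real.exp_sum]
  refine Finset.prod_le_prod (fun j _ => (Real.exp_pos _).le) fun j _ => ?_
  obtain ⟨h0, h1⟩ := div_succ_sq_mem j
  set a := (j : ℝ) / ((j : ℝ) + 1) ^ 2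
  have hc := Real.cos_le_one t
  have hx : Real.cos t ≤ 1 - 2 * (1 - Real.cos t) * a := by nlinarith
  have hx0 : 0 < 1 - 2 * (1 - Real.cos t) * a := ht.trans_le hx
  rw [← Real.le_log_iff_exp_le hx0]
  refine le_trans ?_ (Real.one_sub_inv_le_log_of_pos hx0)
  have : 1 - (1 - 2 * (1 - Real.cos t) * a)⁻¹ =
      -(2 * (1 - Real.cos t) * a / (1 - 2 * (1 - Real.cos t) * a)) := by
    field_simp
    ring
  rw [this, neg_div]
  gcongr

lemma two_mul_one_sub_cos (t : ℝ) : 2 * (1 - Real.cos t) = t ^ 2 * Real.sinc (t / 2) ^ 2 := by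
  have h : 2 * (1 - Real.cos t) = 4 * Real.sin (t / 2) ^ 2 := by
    rw [Real.sin_sq_eq_half_sub]
    ring_nf
  rw [h]
  rcases eq_or_ne t 0 with rfl | ht
  · simp
  · rw [Real.sinc_of_ne_zero (by simpa using ht)]
    field_simp
    ring

lemma tendsto_cycleCharSq (s : ℝ) :
    Tendsto (fun n : ℕ => cycleCharSq n (s / √(Real.log n))) atTop
      (nhds (Real.exp (-s ^ 2))) := by
  have hlog : Tendsto (fun n : ℕ => Real.log n) atTop atTop :=
    Real.tendsto_log_atTop.comp tendsto_natCast_atTop_atTop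
  have hu : Tendsto (fun n : ℕ => s / √(Real.log n)) atTop (nhds 0) :=
    tendsto_const_nhds.div_atTop (Real.tendsto_sqrt_atTop.comp hlog)
  have hcos : Tendsto (fun n : ℕ => Real.cos (s / √(Real.log n))) atTop (nhds 1) := by
    simpa [Function.comp_def] using (Real.continuous_cos.tendsto 0).comp hu
  have hsinc : Tendsto (fun n : ℕ => Real.sinc (s / √(Real.log n) / 2)) atTop (nhds 1) := by
    have h2 := hu.div_const 2
    rw [zero_div] at h2
    simpa [Function.comp_def] using (Real.continuous_sinc.tendsto 0).comp h2
  have hmain : Tendsto (fun n : ℕ => 2 * (1 - Real.cos (s / √(Real.log n))) * cycleVar n) atTop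
      (nhds (s ^ 2)) := by
    have h := ((hsinc.pow 2).mul tendsto_cycleVar_div_log).const_mul (s ^ 2)
    rw [one_pow, one_mul, mul_one] at h
    refine h.congr' ?_
    filter_upwards [hlog.eventually_gt_atTop 0] with n hn
    rw [two_mul_one_sub_cos, div_pow s, Real.sq_sqrt hn.le]
    ring
  have hupper := (Real.continuous_exp.tendsto _).comp hmain.neg
  have hlower := (Real.continuous_exp.tendsto _).comp (hmain.neg.div hcos one_ne_zero)
  rw [div_one] at hlower
  refine tendsto_of_tendsto_of_tendsto_of_le_of_le' hlower hupper ?_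
    (Eventually.of_forall fun n => cycleCharSq_le n _)
  filter_upwards [hcos.eventually_const_lt one_pos] with n hn
  exact le_cycleCharSq n _ hn

lemma continuous_cycleCharSq (n : ℕ) : Continuous (cycleCharSq n) := by
  unfold cycleCharSq
  fun_prop

lemma tendsto_sqrt_log_mul_integral :
    Tendsto (fun n : ℕ => √(Real.log n) * ∫ t in -Real.pi..Real.pi, cycleCharSq n t) atTop
      (nhds √Real.pi) := by
  have hlog : Tendsto (fun n : ℕ => Real.log n) atTop atTop :=
    Real.tendsto_log_atTop.comp tendsto_natCast_atTop_atTop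
  have hsqrt := Real.tendsto_sqrt_atTop.comp hlog
  have hdom : Tendsto (fun n : ℕ => ∫ s : ℝ,
      (Set.Ioc (-Real.pi * √(Real.log n)) (Real.pi * √(Real.log n))).indicator
        (fun s => cycleCharSq n (s / √(Real.log n))) s) atTop
      (nhds (∫ s : ℝ, Real.exp (-s ^ 2))) := by
    refine MeasureTheory.tendsto_integral_filter_of_dominated_convergence
      (fun s => Real.exp (-(2 / Real.pi ^ 2) * s ^ 2)) ?_ ?_
      (integrable_exp_neg_mul_sq (by positivity)) ?_
    · refine Eventually.of_forall fun n => ?_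
      exact ((continuous_cycleCharSq n).comp (by fun_prop)).aestronglyMeasurable.indicator
        measurableSet_Ioc
    · filter_upwards [hlog.eventually_gt_atTop 0,
        tendsto_cycleVar_div_log.eventually_const_lt one_half_lt_one] with n hn hv
      refine Eventually.of_forall fun s => ?_
      by_cases hs : s ∈ Set.Ioc (-Real.pi * √(Real.log n)) (Real.pi * √(Real.log n))
      · rw [Set.indicator_of_mem hs, Real.norm_of_nonneg (cycleCharSq_nonneg _ _)]
        refine (cycleCharSq_le _ _).trans (Real.exp_le_exp.2 ?_)
        have hpos : 0 < √(Real.log n) := Real.sqrt_pos.2 hn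
        have habs : |s / √(Real.log n)| ≤ Real.pi :=
          abs_le.2 ⟨(le_div_iff₀ hpos).2 hs.1.le, (div_le_iff₀ hpos).2 hs.2⟩
        have hc := Real.cos_le_one_sub_mul_cos_sq habs
        rw [div_pow, Real.sq_sqrt hn.le] at hc
        have hv0 : Real.log n / 2 ≤ cycleVar n := by
          rw [lt_div_iff₀ hn] at hv
          linarith
        have hkey : 2 / Real.pi ^ 2 * s ^ 2 ≤
            2 * (1 - Real.cos (s / √(Real.log n))) * cycleVar n := by
          calc 2 / Real.pi ^ 2 * s ^ 2
              = 2 * (2 / Real.pi ^ 2 * (s ^ 2 / Real.log n)) * (Real.log n / 2) := by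
                field_simp
            _ ≤ _ := by
                gcongr
                · nlinarith [Real.cos_le_one (s / √(Real.log n))]
                · linarith
        linarith
      · rw [Set.indicator_of_notMem hs, norm_zero]
        positivity
    · refine Eventually.of_forall fun s => ?_
      refine (tendsto_cycleCharSq s).congr' ?_
      have hlim := hsqrt.const_mul_atTop Real.pi_pos
      filter_upwards [hlim.eventually_gt_atTop |s|] with n hn
      rw [Set.indicator_of_mem]
      have hn' := abs_lt.1 hn
      exact ⟨by simpa using hn'.1, hn'.2.le⟩
  have hgauss := integral_gaussian 1
  simp only [neg_mul, one_mul, div_one] at hgauss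
  rw [hgauss] at hdom
  refine hdom.congr' ?_
  filter_upwards [hlog.eventually_gt_atTop 0] with n hn
  have hpos : 0 < √(Real.log n) := Real.sqrt_pos.2 hn
  rw [MeasureTheory.integral_indicator measurableSet_Ioc,
    ← intervalIntegral.integral_of_le
      (by nlinarith [mul_pos Real.pi_pos hpos]),
    intervalIntegral.integral_comp_div _ hpos.ne', mul_div_cancel_right₀ _ hpos.ne',
    mul_div_cancel_right₀ _ hpos.ne', smul_eq_mul]

/-- The probability that two independent uniformly random permutations of `n` letters
have the same number of cycles is asymptotic to `1 / (2 √(π log n))`. -/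
theorem same_cycle_count_probability_asymptotic :
    Tendsto
      (fun n : ℕ =>
        ((Nat.card {p : Equiv.Perm (Fin n) × Equiv.Perm (Fin n) //
            cycleCount n p.1 = cycleCount n p.2} : ℝ) / (Nat.factorial n : ℝ) ^ 2) *
          (2 * Real.sqrt (Real.pi * Real.log n)))
      atTop (nhds 1) := by
  have h := tendsto_sqrt_log_mul_integral.const_mul (√Real.pi)⁻¹
  rw [inv_mul_cancel₀ (Real.sqrt_ne_zero'.2 Real.pi_pos)] at h
  refine h.congr fun n => ?_
  have hpi : √Real.pi * √Real.pi = Real.pi := Real.mul_self_sqrt Real.pi_pos.le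
  have hpi0 : √Real.pi ≠ 0 := Real.sqrt_ne_zero'.2 Real.pi_pos
  rw [card_same_cycleCount_div, Real.sqrt_mul Real.pi_pos.le]
  field_simp
  rw [sq, hpi]
  ring
end

section
/- Let h : ℝ → ℝ be continuous, 2π-periodic, nonnegative, with h(0) > 0. Then ∫_{0}^{2π} e^{2·t·(cos θ − 1)} · h(θ) dθ ~ h(0)·√(π/t) as the real parameter t → ∞; that is, the ratio of the integral to h(0)·√(π/t) tends to 1. -/
open Filter

/-- The quadratic behaviour of `cos` at its peak, written exactly through `sinc`. -/
theorem two_mul_cos_inv_sqrt_mul_sub_one {t : ℝ} (ht : 0 < t) (x : ℝ) :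
    2 * t * (Real.cos ((√t)⁻¹ * x) - 1) = -(x * Real.sinc ((√t)⁻¹ * x / 2)) ^ 2 := by
  set y := (√t)⁻¹ * x / 2 with hy
  have hs : 0 < √t := Real.sqrt_pos.2 ht
  have hx : x = 2 * √t * y := by rw [hy]; field_simp
  have hcos : Real.cos ((√t)⁻¹ * x) = 1 - 2 * Real.sin y ^ 2 := by
    rw [show (√t)⁻¹ * x = 2 * y by rw [hy]; ring, Real.cos_two_mul, Real.cos_sq']
    ring
  have hsin : y * Real.sinc y = Real.sin y := by
    by_cases h : y = 0
    · simp [h]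
    · rw [Real.sinc_of_ne_zero h, mul_div_cancel₀ _ h]
  have ht' : √t ^ 2 = t := Real.sq_sqrt ht.le
  rw [hcos, hx, mul_assoc (2 * √t), hsin, mul_pow, mul_pow, ht']
  ring

theorem tendsto_inv_sqrt_atTop : Tendsto (fun t : ℝ => (√t)⁻¹) atTop (nhds 0) :=
  tendsto_inv_atTop_zero.comp Real.tendsto_sqrt_atTop

theorem tendsto_sqrt_mul_integral_exp_cos_peak {h : ℝ → ℝ} (hcont : Continuous h) :
    Tendsto (fun t : ℝ => √t * ∫ θ in (-Real.pi)..Real.pi,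
      Real.exp (2 * t * (Real.cos θ - 1)) * h θ) atTop (nhds (h 0 * √Real.pi)) := by
  set I := Set.Ioc (-Real.pi) Real.pi
  obtain ⟨M, hM⟩ := (isCompact_Icc (a := -Real.pi) (b := Real.pi)).exists_bound_of_continuousOn
    hcont.continuousOn
  have hM0 : 0 ≤ M := (norm_nonneg _).trans
    (hM 0 ⟨by linarith [Real.pi_pos], Real.pi_pos.le⟩)
  let G : ℝ → ℝ → ℝ := fun t => I.indicator fun θ => Real.exp (2 * t * (Real.cos θ - 1)) * h θ
  have hresc : ∀ᶠ t : ℝ in atTop, ∫ x, G t ((√t)⁻¹ * x) =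
      √t * ∫ θ in (-Real.pi)..Real.pi, Real.exp (2 * t * (Real.cos θ - 1)) * h θ := by
    filter_upwards with t
    rw [MeasureTheory.Measure.integral_comp_mul_left, inv_inv, abs_of_nonneg (Real.sqrt_nonneg t),
      smul_eq_mul, MeasureTheory.integral_indicator measurableSet_Ioc,
      intervalIntegral.integral_of_le (by linarith [Real.pi_pos])]
  refine Tendsto.congr' hresc ?_
  have hgauss : ∫ x : ℝ, Real.exp (-1 * x ^ 2) * h 0 = h 0 * √Real.pi := by
    rw [MeasureTheory.integral_mul_const, integral_gaussian, div_one, mul_comm]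
  rw [← hgauss]
  refine MeasureTheory.tendsto_integral_filter_of_dominated_convergence
    (fun x => Real.exp (-(4 / Real.pi ^ 2) * x ^ 2) * M) ?_ ?_ ?_ ?_
  · filter_upwards with t
    have hG : Measurable (G t) :=
      Measurable.indicator (Continuous.measurable (by fun_prop)) measurableSet_Ioc
    exact (hG.comp (measurable_const_mul _)).aestronglyMeasurable
  · filter_upwards [eventually_gt_atTop 0] with t ht
    filter_upwards with x
    by_cases hx : (√t)⁻¹ * x ∈ I
    · simp only [G, Set.indicator_of_mem hx, norm_mul, Real.norm_eq_abs, Real.abs_exp]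
      have hcos := Real.cos_le_one_sub_mul_cos_sq (abs_le.2 ⟨hx.1.le, hx.2⟩)
      have hsq : t * ((√t)⁻¹ * x) ^ 2 = x ^ 2 := by
        rw [mul_pow, inv_pow, Real.sq_sqrt ht.le]
        field_simp
      have hexp : 2 * t * (Real.cos ((√t)⁻¹ * x) - 1) ≤ -(4 / Real.pi ^ 2) * x ^ 2 :=
        calc 2 * t * (Real.cos ((√t)⁻¹ * x) - 1)
            ≤ 2 * t * (-(2 / Real.pi ^ 2 * ((√t)⁻¹ * x) ^ 2)) := by gcongr; linarith
          _ = -(4 / Real.pi ^ 2) * (t * ((√t)⁻¹ * x) ^ 2) := by ring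
          _ = -(4 / Real.pi ^ 2) * x ^ 2 := by rw [hsq]
      exact mul_le_mul (Real.exp_le_exp.2 hexp) (hM _ ⟨hx.1.le, hx.2⟩) (abs_nonneg _)
        (Real.exp_pos _).le
    · simp only [G, Set.indicator_of_notMem hx, norm_zero]
      positivity
  · exact (integrable_exp_neg_mul_sq (by positivity)).mul_const M
  · filter_upwards with x
    have hlim : Tendsto (fun t : ℝ => (√t)⁻¹ * x) atTop (nhds 0) := by
      simpa using tendsto_inv_sqrt_atTop.mul_const x
    have hmem : ∀ᶠ t : ℝ in atTop, (√t)⁻¹ * x ∈ I :=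
      hlim (Ioc_mem_nhds (by linarith [Real.pi_pos]) Real.pi_pos)
    have hcts : Continuous fun u : ℝ => Real.exp (-(x * Real.sinc (u / 2)) ^ 2) * h u := by
      fun_prop
    have := (hcts.tendsto 0).comp hlim
    simp only [zero_div, Real.sinc_zero, mul_one] at this
    rw [neg_one_mul]
    refine this.congr' ?_
    filter_upwards [hmem, eventually_gt_atTop 0] with t hx ht
    simp only [G, Set.indicator_of_mem hx, Function.comp_apply,
      two_mul_cos_inv_sqrt_mul_sub_one ht]

/-- Laplace's method instance: for `h` continuous, `2π`-periodic, nonnegative, with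
`h(0) > 0`, we have `∫₀^{2π} e^{2 t (cos θ - 1)} h(θ) dθ ~ h(0) √(π/t)` as `t → ∞`. -/
theorem laplace_method_cos_peak (h : ℝ → ℝ) (hcont : Continuous h)
    (hper : Function.Periodic h (2 * Real.pi)) (hnonneg : ∀ θ, 0 ≤ h θ)
    (hpos : 0 < h 0) :
    Tendsto
      (fun t : ℝ =>
        (∫ θ in (0 : ℝ)..(2 * Real.pi), Real.exp (2 * t * (Real.cos θ - 1)) * h θ) /
          (h 0 * Real.sqrt (Real.pi / t)))
      atTop (nhds 1) := by
  have hne : h 0 * √Real.pi ≠ 0 := (mul_pos hpos (Real.sqrt_pos.2 Real.pi_pos)).ne'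
  have hlim := (tendsto_sqrt_mul_integral_exp_cos_peak hcont).div_const (h 0 * √Real.pi)
  rw [div_self hne] at hlim
  refine hlim.congr fun t => ?_
  have hperiodic : Function.Periodic (fun θ => Real.exp (2 * t * (Real.cos θ - 1)) * h θ)
      (2 * Real.pi) := fun θ => by simp only [Real.cos_add_two_pi, hper θ]
  have hshift := hperiodic.intervalIntegral_add_eq (-Real.pi) 0
  rw [zero_add, show -Real.pi + 2 * Real.pi = Real.pi by ring] at hshift
  rw [hshift, Real.sqrt_div Real.pi_pos.le, ← mul_div_assoc, div_div_eq_mul_div, mul_comm (√t)]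
end
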